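/- Let G be a unicyclic graph whose unique cycle is the odd cycle C_{2n+1} = (x_1,…,x_{2n+1}) (n ≥ 1) such that every vertex of G lies in the closed neighborhood N[V(C_{2n+1})], and let I = I(G) be its edge ideal. Then for every s ≥ 1, the degree-2s graded components of I^s and of the symbolic power I^{(s)} coincide: [I^s]_{2s} = [I^{(s)}]_{2s}. -/

import Mathlib

open MvPolynomial

noncomputable section

/-- The edge ideal of a simple graph: `I(G) = ⟨X_u · X_v : {u,v} ∈ E(G)⟩`. -/
def edgeIdeal (𝕜 : Type) [Field 𝕜] {V : Type} (G : SimpleGraph V) :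
    Ideal (MvPolynomial V 𝕜) :=
  Ideal.span {p | ∃ u v : V, G.Adj u v ∧ p = X u * X v}

/-- `G` is a unicyclic graph (connected with exactly one cycle, equivalently connected with as
many edges as vertices) whose unique cycle is the odd cycle `C_{2n+1}` on the vertices `x j`. -/
structure IsUnicyclicOddCycle {V : Type} [Fintype V] (G : SimpleGraph V) (n : ℕ)
    (x : ZMod (2 * n + 1) → V) : Prop where
  connected : G.Connected
  edge_count : G.edgeSet.ncard = Fintype.card V
  inj : Function.Injective x
  adj_iff : ∀ i j : ZMod (2 * n + 1), G.Adj (x i) (x j) ↔ (j = i + 1 ∨ i = j + 1)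

/-- `f` is a minimal monomial generator of the monomial ideal `J`: it is a monic monomial
belonging to `J` such that no monic monomial of `J` properly divides it. -/
def IsMinMonomialGen {𝕜 : Type} [Field 𝕜] {V : Type} (J : Ideal (MvPolynomial V 𝕜))
    (f : MvPolynomial V 𝕜) : Prop :=
  (∃ m : V →₀ ℕ, f = monomial m 1) ∧ f ∈ J ∧
    ∀ g : MvPolynomial V 𝕜, (∃ m : V →₀ ℕ, g = monomial m 1) → g ∈ J → g ∣ f → g = f

def localizationComap {R : Type} [CommRing R] (p : Ideal R) (hp : p.IsPrime) (J : Ideal R) :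
    Ideal R :=
  letI := hp
  Ideal.comap (algebraMap R (Localization p.primeCompl))
    (Ideal.map (algebraMap R (Localization p.primeCompl)) J)

/-- The `s`-th symbolic power `I^{(s)} = ⋂_{p ∈ Ass(R/I)} (I^s R_p ∩ R)`. -/
def symbolicPower {R : Type} [CommRing R] (I : Ideal R) (s : ℕ) : Ideal R :=
  sInf {J : Ideal R | ∃ (p : Ideal R) (hp : p.IsPrime),
    p ∈ associatedPrimes R (R ⧸ I) ∧ J = localizationComap p hp (I ^ s)}

/-- The `s`-th symbolic defect of `I`: the minimal number of generators of the module
`I^{(s)}/I^s`, i.e. the least `m` such that `I^{(s)} = I^s + (f_1, …, f_m)` for some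
`f_1, …, f_m ∈ I^{(s)}`. -/
def sdefect {R : Type} [CommRing R] (I : Ideal R) (s : ℕ) : ℕ :=
  sInf {m : ℕ | ∃ S : Finset R, S.card = m ∧ (↑S : Set R) ⊆ (symbolicPower I s : Set R) ∧
    I ^ s ⊔ Ideal.span (↑S : Set R) = symbolicPower I s}

open Classical in
/-- grading homomorphism recording the degree in the variables of `W` -/
def psi (𝕜 : Type) [Field 𝕜] {V : Type} (W : V → Prop) :
    MvPolynomial V 𝕜 →ₐ[𝕜] Polynomial (MvPolynomial V 𝕜) :=
  MvPolynomial.aeval (fun v => Polynomial.C (X v) * Polynomial.X ^ (if W v then 1 else 0))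

open Classical in
lemma psi_monomial (𝕜 : Type) [Field 𝕜] {V : Type} [Fintype V] (W : V → Prop)
    (m : V →₀ ℕ) (c : 𝕜) :
    psi 𝕜 W (monomial m c) =
      Polynomial.monomial (∑ v, if W v then m v else 0) (monomial m c) := by
  rw [psi, MvPolynomial.aeval_monomial, Finsupp.prod_fintype _ _ (by simp)]
  simp only [mul_pow, Finset.prod_mul_distrib, ← pow_mul, Finset.prod_pow_eq_pow_sum]
  rw [← Polynomial.C_mul_X_pow_eq_monomial, MvPolynomial.monomial_eq,
    Finsupp.prod_fintype _ _ (by simp)]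
  simp only [map_mul, map_prod, map_pow, mul_assoc]
  have : (∑ v, (if W v then 1 else 0) * m v) = ∑ v, if W v then m v else 0 :=
    Finset.sum_congr rfl fun v _ => by split_ifs <;> simp
  rw [this]
  rfl

open Classical in
lemma psi_coeff (𝕜 : Type) [Field 𝕜] {V : Type} [Fintype V] (W : V → Prop)
    (f : MvPolynomial V 𝕜) (m : V →₀ ℕ) (k : ℕ) :
    ((psi 𝕜 W f).coeff k).coeff m =
      if (∑ v, if W v then m v else 0) = k then f.coeff m else 0 := by
  induction f using MvPolynomial.induction_on' with
  | monomial u a =>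
    rw [psi_monomial, Polynomial.coeff_monomial]
    by_cases hum : u = m
    · subst hum
      split_ifs <;> simp
    · split_ifs <;> simp [MvPolynomial.coeff_monomial, hum]
  | add p q hp hq =>
    rw [map_add, Polynomial.coeff_add, MvPolynomial.coeff_add, hp, hq, MvPolynomial.coeff_add]
    split_ifs <;> simp

open Classical in
lemma symb_support {𝕜 : Type} [Field 𝕜] {V : Type} [Fintype V] (G : SimpleGraph V)
    (W : V → Prop) (hcov : ∀ u v, G.Adj u v → W u ∨ W v)
    (hmin : ∀ w, W w → ∃ u, ¬ W u ∧ G.Adj w u) (s : ℕ) (f : MvPolynomial V 𝕜)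
    (hf : f ∈ symbolicPower (edgeIdeal 𝕜 G) s) (m : V →₀ ℕ) (hm : f.coeff m ≠ 0) :
    s ≤ ∑ v, if W v then m v else 0 := by
  have hT : Prime (Polynomial.X : Polynomial (MvPolynomial V 𝕜)) := Polynomial.prime_X
  set J : Ideal (Polynomial (MvPolynomial V 𝕜)) := Ideal.span {Polynomial.X} with hJ
  have hJp : J.IsPrime := (Ideal.span_singleton_prime hT.ne_zero).2 hT
  set P : Ideal (MvPolynomial V 𝕜) := J.comap (psi 𝕜 W) with hP
  have hPp : P.IsPrime := Ideal.comap_isPrime _ _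
  have memP : ∀ g, g ∈ P ↔ Polynomial.X ∣ psi 𝕜 W g := fun g => by
    rw [hP, Ideal.mem_comap, hJ, Ideal.mem_span_singleton]
  have psiX : ∀ v, psi 𝕜 W (X v) = Polynomial.C (X v) * Polynomial.X ^ (if W v then 1 else 0) :=
    fun v => by rw [psi, MvPolynomial.aeval_X]
  have hXW : ∀ v, W v → (X v : MvPolynomial V 𝕜) ∈ P := fun v hv => by
    rw [memP, psiX, if_pos hv, pow_one]; exact Dvd.intro_left _ rfl
  have hXnW : ∀ v, ¬ W v → (X v : MvPolynomial V 𝕜) ∉ P := fun v hv => by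
    rw [memP, psiX, if_neg hv, pow_zero, mul_one, Polynomial.X_dvd_iff, Polynomial.coeff_C_zero]
    exact MvPolynomial.X_ne_zero v
  have hIP : edgeIdeal 𝕜 G ≤ P := by
    rw [edgeIdeal, Ideal.span_le]
    rintro _ ⟨u, v, huv, rfl⟩
    rcases hcov u v huv with h | h
    · exact P.mul_mem_right _ (hXW u h)
    · exact P.mul_mem_left _ (hXW v h)
  have hPmin : P ∈ (edgeIdeal 𝕜 G).minimalPrimes := by
    refine ⟨⟨hPp, hIP⟩, ?_⟩
    rintro q ⟨hq, hIq⟩ hqP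
    have hXq : ∀ v, W v → (X v : MvPolynomial V 𝕜) ∈ q := fun v hv => by
      obtain ⟨u, hu, huv⟩ := hmin v hv
      have : (X v * X u : MvPolynomial V 𝕜) ∈ q := hIq (Ideal.subset_span ⟨v, u, huv, rfl⟩)
      exact (hq.mem_or_mem this).resolve_right fun h => hXnW u hu (hqP h)
    intro g hg
    rw [MvPolynomial.as_sum g]
    refine Ideal.sum_mem _ fun d hd => ?_
    rw [memP, Polynomial.X_dvd_iff] at hg
    have h0 := psi_coeff 𝕜 W g d 0
    rw [hg, MvPolynomial.coeff_zero] at h0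
    have h1 : (∑ v, if W v then d v else 0) ≠ 0 := by
      intro h
      rw [if_pos h] at h0
      exact (MvPolynomial.mem_support_iff.1 hd) h0.symm
    obtain ⟨v, -, hv⟩ := Finset.exists_ne_zero_of_sum_ne_zero h1
    have hWv : W v := by by_contra h; simp [h] at hv
    rw [if_pos hWv] at hv
    refine Ideal.mem_of_dvd q ?_ (hXq v hWv)
    exact MvPolynomial.X_dvd_monomial.2 (Or.inr hv)
  have hass : P ∈ associatedPrimes (MvPolynomial V 𝕜) (MvPolynomial V 𝕜 ⧸ edgeIdeal 𝕜 G) := by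
    apply Module.associatedPrimes.minimalPrimes_annihilator_subset_associatedPrimes
    rwa [Ideal.annihilator_quotient]
  have hf' : f ∈ localizationComap P hPp (edgeIdeal 𝕜 G ^ s) :=
    (Submodule.mem_sInf.1 hf) _ ⟨P, hPp, hass, rfl⟩
  rw [localizationComap, Ideal.mem_comap,
    IsLocalization.algebraMap_mem_map_algebraMap_iff P.primeCompl] at hf'
  obtain ⟨t, ht, htf⟩ := hf'
  have h1 : psi 𝕜 W (t * f) ∈ J ^ s := by
    have : edgeIdeal 𝕜 G ^ s ≤ (J ^ s).comap (psi 𝕜 W) :=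
      (Ideal.pow_right_mono hIP s).trans (Ideal.le_comap_pow _ _)
    exact this htf
  rw [hJ, Ideal.span_singleton_pow, Ideal.mem_span_singleton, map_mul] at h1
  have ht' : ¬ Polynomial.X ∣ psi 𝕜 W t := fun h => ht ((memP t).2 h)
  have h2 := hT.pow_dvd_of_dvd_mul_left s ht' h1
  by_contra hlt
  push Not at hlt
  have h3 := Polynomial.X_pow_dvd_iff.1 h2 _ hlt
  have h4 := psi_coeff 𝕜 W f m (∑ v, if W v then m v else 0)
  rw [h3, if_pos rfl] at h4
  exact hm (by simpa using h4.symm)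

lemma zmod_succ {n : ℕ} (t : ZMod (2 * n + 1)) :
    ((t + 1).val = t.val + 1 ∧ t + 1 ≠ 0) ∨ ((t + 1).val = 0 ∧ t.val = 2 * n ∧ t + 1 = 0) := by
  have hlt := ZMod.val_lt t
  by_cases h : t.val = 2 * n
  · right
    have h0 : t + 1 = 0 := by
      have : ((t.val + 1 : ℕ) : ZMod (2 * n + 1)) = t + 1 := by simp
      rw [← this, h]
      exact ZMod.natCast_self _
    exact ⟨by rw [h0, ZMod.val_zero], h, h0⟩
  · left
    have h1 : (t + 1).val = t.val + 1 := by
      have : ((t.val + 1 : ℕ) : ZMod (2 * n + 1)) = t + 1 := by simp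
      rw [← this, ZMod.val_natCast, Nat.mod_eq_of_lt (by omega)]
    refine ⟨h1, fun h0 => ?_⟩
    rw [h0, ZMod.val_zero] at h1
    omega

/-- the minimal vertex covers used: `cyc` is the set of cycle vertices, `c` the index -/
def Wset {V : Type} {n : ℕ} (cyc : V → Prop) (c : V → ZMod (2 * n + 1))
    (j : ZMod (2 * n + 1)) (v : V) : Prop :=
  cyc v ↔ Even (c v - j - 1).val

open Classical in
lemma Wset_succ {V : Type} {n : ℕ} (cyc : V → Prop) (c : V → ZMod (2 * n + 1))
    (j : ZMod (2 * n + 1)) (v : V) (a : ℤ) :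
    (if Wset cyc c j v then a else 0) + (if Wset cyc c (j + 1) v then a else 0) =
      a + (if cyc v ∧ c v = j + 1 then a else 0) - (if ¬ cyc v ∧ c v = j + 1 then a else 0) := by
  have h := zmod_succ (c v - (j + 1) - 1)
  have e1 : c v - (j + 1) - 1 + 1 = c v - j - 1 := by ring
  have e2 : c v = j + 1 ↔ c v - j - 1 = 0 := by
    rw [sub_sub, sub_eq_zero]
  rw [e1] at h
  simp only [e2]
  unfold Wset
  rcases h with ⟨h, h'⟩ | ⟨h, h1, h'⟩
  · rw [h]
    simp only [h', and_false, if_false, Nat.even_add_one]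
    by_cases hc : cyc v <;> by_cases he : Even (c v - (j + 1) - 1).val <;> simp [hc, he]
  · rw [h1, h]
    by_cases hc : cyc v <;> simp [hc, h']

open Classical in
lemma core {V : Type} [Fintype V] {n : ℕ} (hn : 1 ≤ n) (x : ZMod (2 * n + 1) → V)
    (cyc : V → Prop) (c : V → ZMod (2 * n + 1)) (hcx : ∀ i, c (x i) = i)
    (hcyc : ∀ v, cyc v ↔ x (c v) = v) (a : V → ℕ) (s : ℕ)
    (ha : ∑ v, a v = 2 * s)
    (hW : ∀ j, s ≤ ∑ v, if Wset cyc c j v then a v else 0) :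
    ∃ e : V → ℕ, ∀ u, a u = e u +
      ∑ v, if x (if cyc v then c v + 1 else c v) = u then e v else 0 := by
  have hxc : ∀ i, cyc (x i) := fun i => by rw [hcyc, hcx]
  set E : ZMod (2 * n + 1) → ℕ := fun j => (∑ v, if Wset cyc c j v then a v else 0) - s with hE
  have key : ∀ j, (E j : ℤ) + E (j + 1) = a (x (j + 1)) -
      ∑ v, (if ¬ cyc v ∧ c v = j + 1 then (a v : ℤ) else 0) := by
    intro j
    have h1 : ∀ j, (E j : ℤ) = (∑ v, if Wset cyc c j v then (a v : ℤ) else 0) - s := by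
      intro j
      rw [hE, Nat.cast_sub (hW j)]
      push_cast
      rfl
    have h2 := Finset.sum_congr (rfl : (Finset.univ : Finset V) = Finset.univ)
      (fun v _ => Wset_succ cyc c j v (a v))
    rw [Finset.sum_add_distrib, Finset.sum_sub_distrib, Finset.sum_add_distrib] at h2
    have h3 : ∑ v, (if cyc v ∧ c v = j + 1 then (a v : ℤ) else 0) = a (x (j + 1)) := by
      rw [Finset.sum_eq_single (x (j + 1))]
      · rw [if_pos ⟨hxc _, hcx _⟩]
      · intro v _ hv
        rw [if_neg]
        rintro ⟨h, h'⟩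
        apply hv
        rw [← h', (hcyc v).1 h]
      · simp
    have h4 : (∑ v, (a v : ℤ)) = 2 * s := by exact_mod_cast ha
    rw [h1, h1]
    linarith
  refine ⟨fun v => if cyc v then E (c v) else a v, fun u => ?_⟩
  by_cases hu : cyc u
  · obtain ⟨j, hj⟩ : ∃ j, c u = j + 1 := ⟨c u - 1, by ring⟩
    have hux : u = x (j + 1) := by rw [← hj, (hcyc u).1 hu]
    have h5 : (∑ v, if x (if cyc v then c v + 1 else c v) = u then
        (if cyc v then E (c v) else a v) else 0) =
        E j + ∑ v, (if ¬ cyc v ∧ c v = j + 1 then a v else 0) := by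
      have : ∀ v, (if x (if cyc v then c v + 1 else c v) = u then
        (if cyc v then E (c v) else a v) else 0) =
        (if v = x j then E j else 0) + (if ¬ cyc v ∧ c v = j + 1 then a v else 0) := by
        intro v
        have hinj : ∀ i k, x i = x k ↔ i = k := fun i k =>
          ⟨fun h => by rw [← hcx i, h, hcx], fun h => by rw [h]⟩
        by_cases hv : cyc v
        · have : v = x j ↔ c v = j := by
            conv_lhs => rw [← (hcyc v).1 hv]
            exact hinj _ _
          simp only [hv, if_true, hux, hinj, add_left_inj, this, not_true, false_and, if_false,
            add_zero]
          by_cases h : c v = j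
          · simp [h]
          · simp [h]
        · have : v ≠ x j := fun h => hv (h ▸ hxc j)
          simp [hv, hux, hinj, this]
      rw [Finset.sum_congr rfl (fun v _ => this v), Finset.sum_add_distrib]
      simp
    rw [h5]
    have := key j
    simp only [hu, if_true, hj]
    rw [hux]
    zify
    linarith
  · have : ∀ v, x (if cyc v then c v + 1 else c v) ≠ u := fun v h => hu (h ▸ hxc _)
    simp [hu, this]

open Classical in
lemma monomial_mem {𝕜 : Type} [Field 𝕜] {V : Type} [Fintype V] (G : SimpleGraph V)
    (p : V → V) (hp : ∀ v, G.Adj v (p v)) (a : V →₀ ℕ) (s : ℕ) (ha : ∑ v, a v = 2 * s)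
    (e : V → ℕ) (he : ∀ u, a u = e u + ∑ v, if p v = u then e v else 0) (k : 𝕜) :
    monomial a k ∈ edgeIdeal 𝕜 G ^ s := by
  have hs : s = ∑ v, e v := by
    have h1 : ∑ u, a u = ∑ u, e u + ∑ u, ∑ v, if p v = u then e v else 0 := by
      rw [← Finset.sum_add_distrib]; exact Finset.sum_congr rfl fun u _ => he u
    rw [Finset.sum_comm] at h1
    simp at h1
    omega
  have h2 : ∀ q : V → MvPolynomial V 𝕜, ∏ u, q u ^ a u = ∏ v, (q v * q (p v)) ^ e v := by
    intro q
    simp only [he, pow_add, Finset.prod_mul_distrib, mul_pow]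
    congr 1
    simp only [← Finset.prod_pow_eq_pow_sum]
    rw [Finset.prod_comm]
    refine Finset.prod_congr rfl fun v _ => ?_
    rw [Finset.prod_eq_single (p v)]
    · simp
    · intro b _ hb
      rw [if_neg (Ne.symm hb), pow_zero]
    · simp
  rw [MvPolynomial.monomial_eq, Finsupp.prod_fintype _ _ (by simp), h2]
  apply Ideal.mul_mem_left
  rw [hs, ← Finset.prod_pow_eq_pow_sum]
  exact Ideal.prod_mem_prod fun v _ =>
    Ideal.pow_mem_pow (show X v * X (p v) ∈ edgeIdeal 𝕜 G from
      Ideal.subset_span ⟨v, p v, hp v, rfl⟩) _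

open Classical in
/-- structure of the graph: all edges are of the form `{v, p v}` -/
lemma graph_struct {V : Type} [Fintype V] (G : SimpleGraph V) (n : ℕ) (hn : 1 ≤ n)
    (x : ZMod (2 * n + 1) → V) (hx : IsUnicyclicOddCycle G n x)
    (hN : ∀ v : V, (∃ j : ZMod (2 * n + 1), v = x j) ∨
      ∃ j : ZMod (2 * n + 1), G.Adj v (x j)) :
    ∃ (cyc : V → Prop) (c : V → ZMod (2 * n + 1)), (∀ i, c (x i) = i) ∧
      (∀ v, cyc v ↔ x (c v) = v) ∧
      ∀ u v, G.Adj u v ↔ (x (if cyc u then c u + 1 else c u) = v ∨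
        x (if cyc v then c v + 1 else c v) = u) := by
  have hex : ∀ v, ∃ j, v = x j ∨ ((∀ i, v ≠ x i) ∧ G.Adj v (x j)) := by
    intro v
    by_cases h : ∃ j, v = x j
    · obtain ⟨j, hj⟩ := h
      exact ⟨j, Or.inl hj⟩
    · obtain ⟨j, hj⟩ := (hN v).resolve_left h
      push Not at h
      exact ⟨j, Or.inr ⟨h, hj⟩⟩
  choose c hc using hex
  have hcx : ∀ i, c (x i) = i := by
    intro i
    rcases hc (x i) with h | h
    · exact hx.inj h.symm
    · exact absurd rfl (h.1 i)
  refine ⟨fun v => x (c v) = v, c, hcx, fun v => Iff.rfl, ?_⟩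
  set p : V → V := fun v => x (if x (c v) = v then c v + 1 else c v) with hp
  have hpadj : ∀ v, G.Adj v (p v) := by
    intro v
    by_cases h : x (c v) = v
    · simp only [hp, h, if_true]
      conv_lhs => rw [← h]
      exact (hx.adj_iff _ _).2 (Or.inl rfl)
    · simp only [hp, h, if_false]
      exact ((hc v).resolve_left fun h' => h h'.symm).2
  have hpx : ∀ v, x (c (p v)) = p v := fun v => by simp only [hp, hcx]
  have htwo : (1 : ZMod (2 * n + 1)) + 1 ≠ 0 := by
    intro h
    have h1 := zmod_succ (n := n) 1
    have h2 := zmod_succ (n := n) 0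
    simp only [zero_add] at h2
    rw [h] at h1
    simp at h1 h2
    omega
  have hinj : Function.Injective (fun v => s(v, p v)) := by
    intro u v huv
    simp only [Sym2.eq_iff] at huv
    rcases huv with h | ⟨h1, h2⟩
    · exact h.1
    · exfalso
      have hu : x (c u) = u := by rw [h1]; exact hpx v
      have hv : x (c v) = v := by rw [← h2]; exact hpx u
      have e1 : p u = x (c u + 1) := by simp only [hp, hu, if_true]
      have e2 : p v = x (c v + 1) := by simp only [hp, hv, if_true]
      rw [e2, ← hu] at h1
      rw [e1, ← hv] at h2
      have h1' := hx.inj h1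
      have h2' := hx.inj h2
      rw [h1'] at h2'
      apply htwo
      have : c v + (1 + 1) = c v + 0 := by rw [← add_assoc, h2', add_zero]
      exact add_left_cancel this
  have hrange : Set.range (fun v => s(v, p v)) = G.edgeSet := by
    apply Set.eq_of_subset_of_ncard_le
    · rintro _ ⟨v, rfl⟩
      exact hpadj v
    · rw [hx.edge_count, Set.ncard_range_of_injective hinj, Nat.card_eq_fintype_card]
    · exact Set.toFinite _
  intro u v
  constructor
  · intro h
    have : s(u, v) ∈ Set.range (fun v => s(v, p v)) := by rw [hrange]; exact h
    obtain ⟨w, hw⟩ := this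
    simp only [Sym2.eq_iff] at hw
    rcases hw with ⟨rfl, h'⟩ | ⟨rfl, h'⟩
    · exact Or.inl h'
    · exact Or.inr h'
  · rintro (h | h)
    · rw [← h]; exact hpadj u
    · rw [← h]; exact (hpadj v).symm

/-- for the edge ideal `I` of a unicyclic graph with unique odd cycle `C_{2n+1}`
all of whose vertices lie in `N[V(C_{2n+1})]`, the degree-`2s` graded components of `I^s` and
`I^{(s)}` coincide for every `s ≥ 1`. -/
theorem unicyclic_graded_component_eq {V : Type} [Fintype V] (𝕜 : Type) [Field 𝕜]
    (G : SimpleGraph V) (n : ℕ) (hn : 1 ≤ n)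
    (x : ZMod (2 * n + 1) → V) (hx : IsUnicyclicOddCycle G n x)
    (hN : ∀ v : V, (∃ j : ZMod (2 * n + 1), v = x j) ∨
      ∃ j : ZMod (2 * n + 1), G.Adj v (x j))
    (s : ℕ) (hs : 1 ≤ s) :
    ∀ f ∈ homogeneousSubmodule V 𝕜 (2 * s),
      (f ∈ (edgeIdeal 𝕜 G) ^ s ↔ f ∈ symbolicPower (edgeIdeal 𝕜 G) s) := by
  classical
  obtain ⟨cyc, c, hcx, hcyc, hadj⟩ := graph_struct G n hn x hx hN
  have hxc : ∀ i, cyc (x i) := fun i => by rw [hcyc, hcx]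
  intro f hf
  constructor
  · intro h
    refine Submodule.mem_sInf.2 ?_
    rintro _ ⟨p, hp, -, rfl⟩
    exact Ideal.le_comap_map h
  · intro h
    rw [MvPolynomial.as_sum f]
    refine Ideal.sum_mem _ fun m hm => ?_
    have hm' : f.coeff m ≠ 0 := MvPolynomial.mem_support_iff.1 hm
    have hdeg : ∑ v, m v = 2 * s := by
      have := (mem_homogeneousSubmodule _ _).1 hf hm'
      rw [← this, Finsupp.weight_apply, Finsupp.sum_fintype _ _ (by simp)]
      simp
    have hcov1 : ∀ j u, Wset cyc c j u ∨ Wset cyc c j (x (if cyc u then c u + 1 else c u)) := by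
      intro j u
      unfold Wset
      by_cases hu : cyc u
      · simp only [hu, if_true, hcx, hxc, true_iff]
        have h := zmod_succ (c u - j - 1)
        have e1 : c u - j - 1 + 1 = c u + 1 - j - 1 := by ring
        rw [e1] at h
        rcases h with ⟨h, -⟩ | ⟨h, h', -⟩
        · rw [h, Nat.even_add_one]; exact em _
        · rw [h]; simp
      · simp only [hu, if_false, hcx, hxc, true_iff, false_iff]
        exact (em _).symm
    have hW : ∀ j, s ≤ ∑ v, if Wset cyc c j v then m v else 0 := by
      intro j
      refine symb_support G (Wset cyc c j) ?_ ?_ s f h m hm'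
      · intro u v huv
        rcases (hadj u v).1 huv with h | h
        · rw [← h]; exact hcov1 j u
        · rw [← h]; exact (hcov1 j v).symm
      · intro w hw
        by_cases hcw : cyc w
        · have he : Even (c w - j - 1).val := hw.1 hcw
          have hwx : w = x (c w) := ((hcyc w).1 hcw).symm
          by_cases hz : (c w - j - 1).val = 2 * n
          · refine ⟨x (c w - 1), ?_, ?_⟩
            · unfold Wset
              simp only [hxc, hcx, true_iff]
              have h := zmod_succ (c w - 1 - j - 1)
              have e1 : c w - 1 - j - 1 + 1 = c w - j - 1 := by ring
              rw [e1, hz] at h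
              rcases h with ⟨h, -⟩ | ⟨h, -⟩
              · rw [Nat.even_iff]; omega
              · omega
            · rw [hwx, hx.adj_iff, hcx]
              right; ring
          · refine ⟨x (c w + 1), ?_, ?_⟩
            · unfold Wset
              simp only [hxc, hcx, true_iff]
              have h := zmod_succ (c w - j - 1)
              have e1 : c w - j - 1 + 1 = c w + 1 - j - 1 := by ring
              rw [e1] at h
              rcases h with ⟨h, -⟩ | ⟨-, h, -⟩
              · rw [h, Nat.even_add_one, not_not]; exact he
              · exact absurd h hz
            · rw [hwx, hx.adj_iff, hcx]
              left; rfl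
        · refine ⟨x (c w), ?_, ?_⟩
          · unfold Wset at hw ⊢
            simp only [hxc, hcx, true_iff]
            intro h
            exact hcw (hw.2 h)
          · rw [hadj]
            left
            rw [if_neg hcw]
    obtain ⟨e, he⟩ := core hn x cyc c hcx hcyc m s hdeg hW
    exact monomial_mem G (fun v => x (if cyc v then c v + 1 else c v))
      (fun v => (hadj v _).2 (Or.inl rfl)) m s hdeg e he _

end
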